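/- Let ψ : ℕ → (0,∞) be a nondecreasing function with ψ(n)/log n → ∞ as n → ∞, and set ζ = limsup_{n→∞} ψ(n+1)/(ψ(1)+⋯+ψ(n)). Then dim_H { E'(c) : c = (c_n)_{n≥1} a strictly increasing sequence of integers with c₁ ≥ 2 and lim_{n→∞} (log(c_n − c_{n−1}))/ψ(n) = 1 } = 1/(1+ζ). -/

import Mathlib

open Filter

noncomputable section

/-- The classical Engel series `E(c) = ∑_{n≥1} 1/(c₁c₂⋯c_n)` (0-based: `c 0 = c₁`). -/
def engel (c : ℕ → ℕ) : ℝ :=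
  ∑' n : ℕ, 1 / ∏ i ∈ Finset.range (n + 1), (c i : ℝ)

/-- The modified Engel series
`E'(c) = 1/c₁ + ∑_{n≥1} 1/((c₁−1)(c₂−1)⋯(c_n−1)·c_{n+1})` (0-based: `c 0 = c₁`). -/
def modEngel (c : ℕ → ℕ) : ℝ :=
  1 / (c 0 : ℝ) +
    ∑' n : ℕ, 1 / ((∏ i ∈ Finset.range (n + 1), ((c i : ℝ) - 1)) * (c (n + 1) : ℝ))

/-- The digit shift `σ(c)_n = c_n + n − 1` (0-based: `σ(c) (n-1) = c (n-1) + (n-1)`). -/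
def engelShift (c : ℕ → ℕ) : ℕ → ℕ := fun n => c n + n

/-- The Pierce series in Perron notation
`Π(c) = ∑_{n≥0} (−1)^n/((c₁−1)⋯(c_n−1)(c_{n+1}−1))` (0-based: `c 0 = c₁`). -/
def pierce (c : ℕ → ℕ) : ℝ :=
  ∑' n : ℕ, (-1 : ℝ) ^ n / ((∏ i ∈ Finset.range n, ((c i : ℝ) - 1)) * ((c n : ℝ) - 1))

/-- The traditional Pierce series `Π̃(d) = ∑_{n≥1} (−1)^{n+1}/(d₁d₂⋯d_n)` (0-based: `d 0 = d₁`). -/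
def pierceTrad (d : ℕ → ℕ) : ℝ :=
  ∑' n : ℕ, (-1 : ℝ) ^ n / ∏ i ∈ Finset.range (n + 1), (d i : ℝ)

end

open scoped ENNReal

/-- `ζ = limsup_n ψ(n+1)/(ψ(1)+⋯+ψ(n))` (as an extended real; 0-based: `ψ 0 = ψ(1)`). -/
noncomputable def zetaExp (ψ : ℕ → ℝ) : ℝ≥0∞ :=
  Filter.limsup (fun n : ℕ => ENNReal.ofReal (ψ n / ∑ k ∈ Finset.range n, ψ k)) atTop


lemma cge (c : ℕ → ℕ) (hc : StrictMono c) (h0 : 2 ≤ c 0) (i : ℕ) : (2:ℝ) ≤ c i := by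
  have : c 0 ≤ c i := hc.monotone (Nat.zero_le i)
  exact_mod_cast h0.trans this

noncomputable def eP (c : ℕ → ℕ) (n : ℕ) : ℝ := ∏ i ∈ Finset.range n, ((c i : ℝ) - 1)
noncomputable def eT (c : ℕ → ℕ) (n : ℕ) : ℝ := 1 / (eP c n * c n)

lemma eP_pos (c : ℕ → ℕ) (hc : StrictMono c) (h0 : 2 ≤ c 0) (n : ℕ) : 0 < eP c n :=
  Finset.prod_pos fun i _ => by linarith [cge c hc h0 i]

lemma eP_succ (c : ℕ → ℕ) (n : ℕ) : eP c (n+1) = eP c n * ((c n : ℝ) - 1) := by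
  simp [eP, Finset.prod_range_succ]

lemma eT_nonneg (c : ℕ → ℕ) (hc : StrictMono c) (h0 : 2 ≤ c 0) (n : ℕ) : 0 ≤ eT c n := by
  have := eP_pos c hc h0 n
  unfold eT; positivity

lemma eT_le (c : ℕ → ℕ) (hc : StrictMono c) (h0 : 2 ≤ c 0) (k : ℕ) :
    eT c k ≤ 1 / eP c (k+1) - 1 / eP c (k+2) := by
  have hp := eP_pos c hc h0 k
  have h1 := cge c hc h0 k
  have h2 : (c k : ℝ) + 1 ≤ c (k+1) := by exact_mod_cast hc (Nat.lt_succ_self k)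
  rw [show k + 2 = k + 1 + 1 from rfl, eP_succ c (k+1), eP_succ c k, eT]
  have h3 : 1 / (eP c k * ((c k : ℝ) - 1)  * ((c (k+1) : ℝ) - 1)) ≤
      1 / (eP c k * ((c k : ℝ) - 1)  * (c k : ℝ)) := by
    have : 0 < (c k : ℝ) - 1 := by linarith
    apply one_div_le_one_div_of_le (by positivity)
    gcongr
    linarith
  have h4 : 1 / (eP c k * (c k : ℝ)) = 1 / (eP c k * ((c k : ℝ) - 1)) -
      1 / (eP c k * ((c k : ℝ) - 1)  * (c k : ℝ)) := by
    have : (c k : ℝ) - 1 ≠ 0 := by linarith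
    have : (c k : ℝ) ≠ 0 := by linarith
    field_simp
  rw [h4]; linarith

lemma eT_partial (c : ℕ → ℕ) (hc : StrictMono c) (h0 : 2 ≤ c 0) (n m : ℕ) :
    ∑ i ∈ Finset.range m, eT c (i + n) ≤ 1 / eP c (n+1) - 1 / eP c (m + n + 1) := by
  induction m with
  | zero => simp
  | succ m ih =>
    rw [Finset.sum_range_succ]
    have := eT_le c hc h0 (m + n)
    rw [show m + 1 + n + 1 = m + n + 2 by ring]
    linarith

lemma eT_partial' (c : ℕ → ℕ) (hc : StrictMono c) (h0 : 2 ≤ c 0) (n m : ℕ) :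
    ∑ i ∈ Finset.range m, eT c (i + n) ≤ 1 / eP c (n+1) := by
  have := eT_partial c hc h0 n m
  have h := eP_pos c hc h0 (m + n + 1)
  have : 0 < 1 / eP c (m+n+1) := by positivity
  linarith

lemma eT_summable (c : ℕ → ℕ) (hc : StrictMono c) (h0 : 2 ≤ c 0) : Summable (eT c) :=
  summable_of_sum_range_le (eT_nonneg c hc h0) (fun m => by simpa using eT_partial' c hc h0 0 m)

lemma modEngel_eq (c : ℕ → ℕ) (hc : StrictMono c) (h0 : 2 ≤ c 0) :
    modEngel c = ∑' n, eT c n := by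
  rw [(eT_summable c hc h0).tsum_eq_zero_add]
  simp [modEngel, eT, eP]

lemma modEngel_upper (c : ℕ → ℕ) (hc : StrictMono c) (h0 : 2 ≤ c 0) (n : ℕ) :
    modEngel c ≤ ∑ i ∈ Finset.range n, eT c i + 1 / eP c (n+1) := by
  rw [modEngel_eq c hc h0, ← (eT_summable c hc h0).sum_add_tsum_nat_add n]
  gcongr
  exact Real.tsum_le_of_sum_range_le (fun i => eT_nonneg c hc h0 _) (fun m => eT_partial' c hc h0 n m)

lemma modEngel_lower (c : ℕ → ℕ) (hc : StrictMono c) (h0 : 2 ≤ c 0) (n : ℕ) :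
    ∑ i ∈ Finset.range n, eT c i + eT c n ≤ modEngel c := by
  rw [modEngel_eq c hc h0, ← Finset.sum_range_succ]
  exact (eT_summable c hc h0).sum_le_tsum _ (fun i _ => eT_nonneg c hc h0 i)

lemma eP_congr (c c' : ℕ → ℕ) (n : ℕ) (h : ∀ i < n, c i = c' i) : eP c n = eP c' n :=
  Finset.prod_congr rfl fun i hi => by rw [h i (Finset.mem_range.1 hi)]

lemma eT_congr (c c' : ℕ → ℕ) (n : ℕ) (h : ∀ i < n, c i = c' i) :
    ∑ i ∈ Finset.range n, eT c i = ∑ i ∈ Finset.range n, eT c' i :=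
  Finset.sum_congr rfl fun i hi => by
    have hi := Finset.mem_range.1 hi
    rw [eT, eT, h i hi, eP_congr c c' i (fun j hj => h j (hj.trans hi))]

lemma modEngel_sep (c c' : ℕ → ℕ) (hc : StrictMono c) (h0 : 2 ≤ c 0) (hc' : StrictMono c')
    (h0' : 2 ≤ c' 0) (n k : ℕ) (h : ∀ i < n, c i = c' i) (hk : 1 ≤ k) (hn : c' n = c n + 2 * k)
    (L : ℕ → ℝ) (hL : ∀ i, (c i : ℝ) ≤ L i) (hL' : ∀ i, (c' i : ℝ) ≤ L i) :
    k / ((∏ i ∈ Finset.range n, L i) * L n ^ 2) ≤ modEngel c - modEngel c' := by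
  have h1 := modEngel_lower c hc h0 n
  have h2 := modEngel_upper c' hc' h0' n
  rw [← eT_congr c c' n h] at h2
  have hp := eP_pos c hc h0 n
  rw [eP_succ, ← eP_congr c c' n h] at h2
  have hcn := cge c hc h0 n
  have hk' : (1:ℝ) ≤ k := by exact_mod_cast hk
  have hn' : (c' n : ℝ) = c n + 2 * k := by exact_mod_cast hn
  have h3 : eT c n - 1 / (eP c n * ((c' n : ℝ) - 1)) = (2 * k - 1) / (eP c n * c n * (c' n - 1)) := by
    have : (c n : ℝ) ≠ 0 := by linarith
    have : (c' n : ℝ) - 1 ≠ 0 := by linarith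
    rw [eT]
    field_simp
    rw [hn']; ring
  have h4 : k / ((∏ i ∈ Finset.range n, L i) * L n ^ 2) ≤
      (2 * k - 1) / (eP c n * c n * ((c' n : ℝ) - 1)) := by
    have a1 : 0 < (c' n : ℝ) - 1 := by linarith
    have a2 : eP c n ≤ ∏ i ∈ Finset.range n, L i :=
      Finset.prod_le_prod (fun i _ => by linarith [cge c hc h0 i]) (fun i _ => by linarith [hL i])
    have a3 := hL n
    have a4 := hL' n
    have a5 : 0 ≤ L n := by linarith
    have a6 : 0 ≤ (∏ i ∈ Finset.range n, L i) * L n := mul_nonneg (hp.le.trans a2) a5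
    apply div_le_div₀ (by linarith) (by linarith) (by positivity)
    calc eP c n * c n * ((c' n : ℝ) - 1) ≤ (∏ i ∈ Finset.range n, L i) * L n * L n := by
          gcongr <;> first | exact a6 | positivity | linarith
      _ = _ := by ring
  linarith

lemma dim_of_antiholder (F : ℝ → ℝ) (A : Set ℝ) (C s : ℝ) (hC : 0 ≤ C) (hs : 0 < s)
    (h : ∀ y ∈ A, ∀ y' ∈ A, |y - y'| ≤ C * |F y - F y'| ^ s) :
    ENNReal.ofReal s * dimH A ≤ dimH (F '' A) := by
  have hinj : Set.InjOn F A := by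
    intro y hy y' hy' e
    have := h y hy y' hy'
    rw [e, sub_self, abs_zero, Real.zero_rpow hs.ne', mul_zero] at this
    have := abs_nonpos_iff.1 this
    linarith
  have hg : HolderOnWith C.toNNReal s.toNNReal (Function.invFunOn F A) (F '' A) := by
    rintro _ ⟨y, hy, rfl⟩ _ ⟨y', hy', rfl⟩
    rw [hinj.leftInvOn_invFunOn hy, hinj.leftInvOn_invFunOn hy']
    rw [edist_dist, edist_dist, Real.dist_eq, Real.dist_eq, Real.coe_toNNReal s hs.le,
      ENNReal.ofReal_rpow_of_nonneg (abs_nonneg _) hs.le]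
    rw [← ENNReal.ofReal, ← ENNReal.ofReal_mul hC]
    exact ENNReal.ofReal_le_ofReal (h y hy y' hy')
  have h1 := hg.dimH_image_le (by simpa using hs)
  rw [hinj.invFunOn_image subset_rfl] at h1
  have h2 : (ENNReal.ofReal s) ≠ 0 := by simpa using hs
  calc _ ≤ ENNReal.ofReal s * (dimH (F '' A) / ENNReal.ofReal s) := by gcongr; exact h1
    _ = _ := ENNReal.mul_div_cancel h2 ENNReal.ofReal_ne_top

/-- mixed radix remainder -/
noncomputable def rem (M : ℕ → ℕ) (y : ℝ) : ℕ → ℝ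
  | 0 => y
  | n+1 => Int.fract (M n * rem M y n)

noncomputable def dig (M : ℕ → ℕ) (y : ℝ) (n : ℕ) : ℕ := ⌊M n * rem M y n⌋₊

lemma rem_mem (M : ℕ → ℕ) (y : ℝ) (hy : y ∈ Set.Ico (0:ℝ) 1) (n : ℕ) :
    rem M y n ∈ Set.Ico (0:ℝ) 1 := by
  cases n with
  | zero => exact hy
  | succ n => exact ⟨Int.fract_nonneg _, Int.fract_lt_one _⟩

lemma dig_lt (M : ℕ → ℕ) (hM : ∀ n, 2 ≤ M n) (y : ℝ) (hy : y ∈ Set.Ico (0:ℝ) 1) (n : ℕ) :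
    dig M y n < M n := by
  have := rem_mem M y hy n
  have h2 : (2:ℝ) ≤ M n := by exact_mod_cast hM n
  rw [dig, Nat.floor_lt (mul_nonneg (by positivity) this.1)]
  nlinarith [this.2]

lemma dig_add (M : ℕ → ℕ) (y : ℝ) (hy : y ∈ Set.Ico (0:ℝ) 1) (n : ℕ) :
    M n * rem M y n = dig M y n + rem M y (n+1) := by
  have := rem_mem M y hy n
  have h : 0 ≤ (M n : ℝ) * rem M y n := mul_nonneg (by positivity) this.1
  rw [dig, rem, natCast_floor_eq_intCast_floor h, Int.floor_add_fract]

lemma rem_sub (M : ℕ → ℕ) (y y' : ℝ) (hy : y ∈ Set.Ico (0:ℝ) 1) (hy' : y' ∈ Set.Ico (0:ℝ) 1)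
    (n : ℕ) (h : ∀ i < n, dig M y i = dig M y' i) :
    (∏ i ∈ Finset.range n, (M i : ℝ)) * (y - y') = rem M y n - rem M y' n := by
  induction n with
  | zero => simp [rem]
  | succ n ih =>
    have := ih (fun i hi => h i (by omega))
    have h1 := dig_add M y hy n
    have h2 := dig_add M y' hy' n
    rw [h n (by omega)] at h1
    rw [Finset.prod_range_succ, mul_right_comm, this]
    linarith

lemma dig_diff (M : ℕ → ℕ) (hM : ∀ n, 2 ≤ M n) (y y' : ℝ) (hy : y ∈ Set.Ico (0:ℝ) 1)
    (hy' : y' ∈ Set.Ico (0:ℝ) 1) (hne : y ≠ y') : ∃ n, dig M y n ≠ dig M y' n := by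
  by_contra! h
  have hpos : 0 < |y - y'| := abs_pos.2 (sub_ne_zero.2 hne)
  obtain ⟨n, hn⟩ := pow_unbounded_of_one_lt (1 / |y - y'|) (one_lt_two)
  have h1 := rem_sub M y y' hy hy' n (fun i _ => h i)
  have a := rem_mem M y hy n
  have b := rem_mem M y' hy' n
  have h2 : |rem M y n - rem M y' n| ≤ 1 := abs_le.2 ⟨by linarith [a.1, b.2], by linarith [a.2, b.1]⟩
  rw [← h1, abs_mul] at h2
  have h3 : (2:ℝ)^n ≤ ∏ i ∈ Finset.range n, (M i : ℝ) := by
    have := Finset.prod_le_prod (s := Finset.range n) (f := fun _ => (2:ℝ)) (g := fun i => (M i : ℝ))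
      (fun i _ => by norm_num) (fun i _ => by exact_mod_cast hM i)
    simpa using this
  have h4 := h3.trans (le_abs_self _)
  rw [div_lt_iff₀ hpos] at hn
  nlinarith

lemma dig_dist (M : ℕ → ℕ) (hM : ∀ n, 2 ≤ M n) (y y' : ℝ) (hy : y ∈ Set.Ico (0:ℝ) 1)
    (hy' : y' ∈ Set.Ico (0:ℝ) 1) (n k : ℕ) (h : ∀ i < n, dig M y i = dig M y' i)
    (hk : 1 ≤ k) (hn : dig M y' n = dig M y n + k) :
    |y - y'| ≤ 2 * k / ∏ i ∈ Finset.range (n+1), (M i : ℝ) := by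
  have h1 := rem_sub M y y' hy hy' n h
  have e1 := dig_add M y hy n
  have e2 := dig_add M y' hy' n
  have a := rem_mem M y hy (n+1)
  have b := rem_mem M y' hy' (n+1)
  have hQ : 0 < ∏ i ∈ Finset.range (n+1), (M i : ℝ) :=
    Finset.prod_pos fun i _ => by have := hM i; positivity
  rw [le_div_iff₀ hQ]
  have hk' : (1:ℝ) ≤ k := by exact_mod_cast hk
  have hn' : (dig M y' n : ℝ) = dig M y n + k := by exact_mod_cast hn
  have e3 : (y - y') * ∏ i ∈ Finset.range (n+1), (M i : ℝ) =
      -k + (rem M y (n+1) - rem M y' (n+1)) := by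
    rw [Finset.prod_range_succ]
    calc _ = ((∏ i ∈ Finset.range n, (M i : ℝ)) * (y - y')) * M n := by ring
      _ = _ := by rw [h1]; linarith
  rw [← abs_of_pos hQ, ← abs_mul, e3, abs_le]
  constructor <;> linarith [a.1, a.2, b.1, b.2]

section asymp
variable (ψ : ℕ → ℝ) (hψpos : ∀ n, 0 < ψ n) 
    (hψ : Tendsto (fun n : ℕ => ψ n / Real.log ((n : ℝ) + 1)) atTop atTop)

lemma tendsto_log_succ : Tendsto (fun n : ℕ => Real.log ((n:ℝ) + 1)) atTop atTop :=
  Real.tendsto_log_atTop.comp (tendsto_atTop_add_const_right _ _ tendsto_natCast_atTop_atTop)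

lemma psi_tendsto (ψ : ℕ → ℝ)
    (hψ : Tendsto (fun n : ℕ => ψ n / Real.log ((n : ℝ) + 1)) atTop atTop) :
    Tendsto ψ atTop atTop := by
  have h := hψ.atTop_mul_atTop₀ tendsto_log_succ
  refine h.congr' ?_
  filter_upwards [tendsto_log_succ.eventually_gt_atTop 0] with n hn
  exact div_mul_cancel₀ _ hn.ne'

lemma log_littleO (ψ : ℕ → ℝ) (hψpos : ∀ n, 0 < ψ n)
    (hψ : Tendsto (fun n : ℕ => ψ n / Real.log ((n : ℝ) + 1)) atTop atTop) (K : ℝ) :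
    (fun n : ℕ => K + Real.log ((n:ℝ) + 1)) =o[atTop] ψ := by
  refine Asymptotics.IsLittleO.add ?_ ?_
  · apply Asymptotics.isLittleO_const_left.2
    right
    exact tendsto_norm_atTop_atTop.comp (psi_tendsto ψ hψ)
  · rw [Asymptotics.isLittleO_iff_tendsto (fun n hn => absurd hn (hψpos n).ne')]
    refine (tendsto_inv_atTop_zero.comp hψ).congr fun n => ?_
    simp

lemma const_littleO (ψ : ℕ → ℝ)
    (hψ : Tendsto (fun n : ℕ => ψ n / Real.log ((n : ℝ) + 1)) atTop atTop) (K : ℝ) :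
    (fun _ : ℕ => K) =o[atTop] ψ := by
  apply Asymptotics.isLittleO_const_left.2
  right
  exact tendsto_norm_atTop_atTop.comp (psi_tendsto ψ hψ)

lemma sum_tendsto (ψ : ℕ → ℝ) (hψpos : ∀ n, 0 < ψ n)
    (hψ : Tendsto (fun n : ℕ => ψ n / Real.log ((n : ℝ) + 1)) atTop atTop) :
    Tendsto (fun n => ∑ i ∈ Finset.range n, ψ i) atTop atTop := by
  rw [← tendsto_add_atTop_iff_nat 1]
  refine tendsto_atTop_mono (fun n => ?_) (psi_tendsto ψ hψ)
  rw [Finset.sum_range_succ]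
  have : 0 ≤ ∑ i ∈ Finset.range n, ψ i := Finset.sum_nonneg fun i _ => (hψpos i).le
  linarith

lemma sum_small (ψ : ℕ → ℝ) (hψpos : ∀ n, 0 < ψ n)
    (hψ : Tendsto (fun n : ℕ => ψ n / Real.log ((n : ℝ) + 1)) atTop atTop) (e : ℕ → ℝ)
    (he : e =o[atTop] ψ) (δ : ℝ) (hδ : 0 < δ) :
    ∀ᶠ n in atTop, ∑ i ∈ Finset.range n, e i ≤ δ * ∑ i ∈ Finset.range n, ψ i := by
  have := (he.sum_range (fun i => (hψpos i).le) (sum_tendsto ψ hψpos hψ)).bound hδ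
  filter_upwards [this] with n hn
  have h2 : 0 ≤ ∑ i ∈ Finset.range n, ψ i := Finset.sum_nonneg fun i _ => (hψpos i).le
  rw [Real.norm_of_nonneg h2] at hn
  exact (le_abs_self _).trans hn

lemma term_small (ψ : ℕ → ℝ) (hψpos : ∀ n, 0 < ψ n) (e : ℕ → ℝ)
    (he : e =o[atTop] ψ) (δ : ℝ) (hδ : 0 < δ) :
    ∀ᶠ n in atTop, e n ≤ δ * ψ n := by
  filter_upwards [he.bound hδ] with n hn
  rw [Real.norm_of_nonneg (hψpos n).le] at hn
  exact (le_abs_self _).trans hn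

lemma exists_bound (f : ℕ → ℝ) (B : ℝ) (h : ∀ᶠ n in atTop, f n ≤ B) : ∃ C, ∀ n, f n ≤ C := by
  obtain ⟨N, hN⟩ := eventually_atTop.1 h
  obtain ⟨C, hC⟩ := ((Finset.range N).image f).bddAbove
  refine ⟨max B C, fun n => ?_⟩
  by_cases hn : n < N
  · exact le_max_of_le_right (hC (by simpa using ⟨n, hn, rfl⟩))
  · exact le_max_of_le_left (hN n (by omega))

end asymp

section lower

noncomputable def MM (ψ : ℕ → ℝ) (n : ℕ) : ℕ := ⌈Real.exp (ψ n)⌉₊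

lemma MM_two (ψ : ℕ → ℝ) (hψpos : ∀ n, 0 < ψ n) (n : ℕ) : 2 ≤ MM ψ n := by
  have : 1 < MM ψ n := by
    rw [MM, Nat.lt_ceil]; simpa using hψpos n
  omega

lemma MM_ge (ψ : ℕ → ℝ) (n : ℕ) : Real.exp (ψ n) ≤ MM ψ n := Nat.le_ceil _

lemma MM_le (ψ : ℕ → ℝ) (hψpos : ∀ n, 0 < ψ n) (n : ℕ) : (MM ψ n : ℝ) ≤ 2 * Real.exp (ψ n) := by
  have h1 := Nat.ceil_lt_add_one (Real.exp_pos (ψ n)).le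
  have h2 := Real.one_le_exp (hψpos n).le
  rw [MM]; linarith

noncomputable def cc (ψ : ℕ → ℝ) (y : ℝ) (n : ℕ) : ℕ :=
  ∑ i ∈ Finset.range (n+1), (MM ψ i + 2 * dig (MM ψ) y i)

lemma cc_succ (ψ : ℕ → ℝ) (y : ℝ) (n : ℕ) :
    cc ψ y (n+1) = cc ψ y n + (MM ψ (n+1) + 2 * dig (MM ψ) y (n+1)) := by
  rw [cc, Finset.sum_range_succ]; rfl

lemma cc_mono (ψ : ℕ → ℝ) (hψpos : ∀ n, 0 < ψ n) (y : ℝ) : StrictMono (cc ψ y) := by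
  refine strictMono_nat_of_lt_succ fun n => ?_
  have := MM_two ψ hψpos (n+1)
  rw [cc_succ]; omega

lemma cc_zero (ψ : ℕ → ℝ) (hψpos : ∀ n, 0 < ψ n) (y : ℝ) : 2 ≤ cc ψ y 0 := by
  have := MM_two ψ hψpos 0
  simp [cc]; omega

lemma d_le (ψ : ℕ → ℝ) (hψpos : ∀ n, 0 < ψ n) (y : ℝ) (hy : y ∈ Set.Ico (0:ℝ) 1) (i : ℕ) :
    ((MM ψ i + 2 * dig (MM ψ) y i : ℕ) : ℝ) ≤ 6 * Real.exp (ψ i) := by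
  have h1 : (dig (MM ψ) y i : ℝ) < MM ψ i := by exact_mod_cast dig_lt _ (MM_two ψ hψpos) y hy i
  have h2 := MM_le ψ hψpos i
  push_cast; linarith

lemma cc_le (ψ : ℕ → ℝ) (hψpos : ∀ n, 0 < ψ n) (hψmono : Monotone ψ) (y : ℝ)
    (hy : y ∈ Set.Ico (0:ℝ) 1) (n : ℕ) :
    (cc ψ y n : ℝ) ≤ Real.exp (ψ n + (Real.log 6 + Real.log ((n:ℝ)+1))) := by
  rw [Real.exp_add, Real.exp_add, Real.exp_log (by norm_num), Real.exp_log (by positivity), cc]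
  push_cast
  calc _ ≤ ∑ i ∈ Finset.range (n+1), 6 * Real.exp (ψ n) := by
        refine Finset.sum_le_sum fun i hi => ?_
        have := d_le ψ hψpos y hy i
        push_cast at this
        refine this.trans ?_
        gcongr
        exact hψmono (by have := Finset.mem_range.1 hi; omega)
    _ = _ := by simp; ring

lemma cc_lim (ψ : ℕ → ℝ) (hψpos : ∀ n, 0 < ψ n) 
    (hψ : Tendsto (fun n : ℕ => ψ n / Real.log ((n : ℝ) + 1)) atTop atTop) (y : ℝ)
    (hy : y ∈ Set.Ico (0:ℝ) 1) :
    Tendsto (fun n : ℕ => Real.log ((cc ψ y (n + 1) : ℝ) - (cc ψ y n : ℝ)) / ψ (n + 1)) atTop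
          (nhds 1) := by
  suffices h : Tendsto (fun n : ℕ => Real.log ((MM ψ n + 2 * dig (MM ψ) y n : ℕ) : ℝ) / ψ n) atTop
          (nhds 1) by
    refine (h.comp (tendsto_add_atTop_nat 1)).congr fun n => ?_
    simp only [Function.comp]
    rw [cc_succ]; push_cast; congr 2; ring
  have h6 : Tendsto (fun n => 1 + Real.log 6 / ψ n) atTop (nhds (1 + 0)) :=
    tendsto_const_nhds.add ((psi_tendsto ψ hψ).const_div_atTop _)
  rw [add_zero] at h6
  refine tendsto_of_tendsto_of_tendsto_of_le_of_le tendsto_const_nhds h6 (fun n => ?_) (fun n => ?_)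
  · have : Real.exp (ψ n) ≤ ((MM ψ n + 2 * dig (MM ψ) y n : ℕ) : ℝ) := by
      refine (MM_ge ψ n).trans ?_
      exact_mod_cast Nat.le_add_right _ _
    simp only
    rw [le_div_iff₀ (hψpos n), one_mul, Real.le_log_iff_exp_le ((Real.exp_pos _).trans_le this)]
    exact this
  · have h0 : Real.exp (ψ n) ≤ ((MM ψ n + 2 * dig (MM ψ) y n : ℕ) : ℝ) := by
      refine (MM_ge ψ n).trans ?_
      exact_mod_cast Nat.le_add_right _ _
    have h1 := d_le ψ hψpos y hy n
    have h2 := Real.log_le_log ((Real.exp_pos _).trans_le h0) h1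
    rw [Real.log_mul (by norm_num) (Real.exp_pos _).ne', Real.log_exp] at h2
    simp only
    rw [div_le_iff₀ (hψpos n), add_mul, div_mul_cancel₀ _ (hψpos n).ne']
    linarith

lemma holder_arith (s C k D Mn Q W Y : ℝ) (hs : 0 < s) (hs1 : s < 1) (hk : 1 ≤ k) (hkM : k ≤ Mn)
    (hQ : 0 < Q) (hW : 0 < W) (hD : k / W ≤ D) (hY : Y ≤ 2 * k / Q) (hC : 0 < C)
    (H : 2 * Mn ^ (1 - s) * W ^ s ≤ C * Q) : Y ≤ C * D ^ s := by
  have hk0 : 0 < k := by linarith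
  have h1 : k ^ s / W ^ s ≤ D ^ s := by
    rw [← Real.div_rpow hk0.le hW.le]
    exact Real.rpow_le_rpow (by positivity) hD hs.le
  have h2 : k = k ^ (1 - s) * k ^ s := by
    rw [← Real.rpow_add hk0]; simp
  have h3 : k ^ (1-s) ≤ Mn ^ (1-s) := Real.rpow_le_rpow hk0.le hkM (by linarith)
  have hWs : 0 < W ^ s := by positivity
  have hks : 0 < k ^ s := by positivity
  calc Y ≤ 2 * k / Q := hY
    _ ≤ C * (k ^ s / W ^ s) := by
      rw [← mul_div_assoc, div_le_div_iff₀ hQ hWs]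
      calc 2 * k * W ^ s = 2 * (k ^ (1-s) * k ^ s) * W ^ s := by rw [← h2]
        _ = 2 * k ^ (1-s) * W ^ s * k ^ s := by ring
        _ ≤ 2 * Mn ^ (1-s) * W ^ s * k ^ s := by gcongr
        _ ≤ C * Q * k ^ s := by gcongr
        _ = _ := by ring
    _ ≤ _ := by gcongr

lemma const_exists (ψ : ℕ → ℝ) (hψpos : ∀ n, 0 < ψ n)
    (hψ : Tendsto (fun n : ℕ => ψ n / Real.log ((n : ℝ) + 1)) atTop atTop)
    (s z : ℝ) (hs : 0 < s) (hz : 0 ≤ z) (hsz : s * (1 + z) < 1)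
    (hev : ∀ᶠ n in atTop, ψ n ≤ z * ∑ k ∈ Finset.range n, ψ k) :
    ∃ C > 0, ∀ n, 2 * (MM ψ n : ℝ) ^ (1 - s) *
      ((∏ i ∈ Finset.range n, Real.exp (ψ i + (Real.log 6 + Real.log ((i:ℝ)+1)))) *
        Real.exp (ψ n + (Real.log 6 + Real.log ((n:ℝ)+1))) ^ 2) ^ s ≤
      C * ∏ i ∈ Finset.range (n+1), (MM ψ i : ℝ) := by
  set e : ℕ → ℝ := fun n => Real.log 6 + Real.log ((n:ℝ)+1) with he
  have heo : e =o[atTop] ψ := log_littleO ψ hψpos hψ _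
  obtain ⟨δ, hδ, hδ2⟩ : ∃ δ > 0, s * (1 + 2 * δ) * (1 + z) ≤ 1 := by
    refine ⟨(1 - s * (1+z)) / 2 / (s * (1+z)), by apply div_pos <;> nlinarith, ?_⟩
    have : 0 < s * (1+z) := by positivity
    field_simp
    linarith
  obtain ⟨B, hB⟩ := exists_bound (fun n => s * (∑ i ∈ Finset.range n, (ψ i + e i) +
      ψ n + 2 * e n) - ∑ i ∈ Finset.range n, ψ i) 0 (by
    filter_upwards [hev, sum_small ψ hψpos hψ e heo δ hδ, term_small ψ hψpos e heo δ hδ]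
      with n h1 h2 h3
    have h4 : 0 ≤ ∑ i ∈ Finset.range n, ψ i := Finset.sum_nonneg fun i _ => (hψpos i).le
    rw [Finset.sum_add_distrib]
    set S := ∑ i ∈ Finset.range n, ψ i
    have h5 : S + ∑ i ∈ Finset.range n, e i + ψ n + 2 * e n ≤ (1 + 2 * δ) * ((1 + z) * S) := by
      have := mul_le_mul_of_nonneg_left h1 (show 0 ≤ 1 + 2 * δ by linarith)
      have := mul_nonneg hδ.le h4
      nlinarith
    have h6 := mul_le_mul_of_nonneg_left h5 hs.le
    have h7 := mul_le_mul_of_nonneg_right hδ2 h4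
    nlinarith)
  refine ⟨2 * Real.exp B, by positivity, fun n => ?_⟩
  have hB := hB n
  have hM : ∀ i, 0 < (MM ψ i : ℝ) := fun i => (Real.exp_pos _).trans_le (MM_ge ψ i)
  obtain ⟨m, hm⟩ : ∃ m : ℕ → ℝ, ∀ i, (MM ψ i : ℝ) = Real.exp (m i) :=
    ⟨fun i => Real.log (MM ψ i), fun i => (Real.exp_log (hM i)).symm⟩
  have hml : ∀ i, ψ i ≤ m i := fun i => by
    have := MM_ge ψ i
    rwa [hm, Real.exp_le_exp] at this
  have hs' : ∑ i ∈ Finset.range n, ψ i ≤ ∑ i ∈ Finset.range n, m i :=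
    Finset.sum_le_sum fun i _ => hml i
  simp_rw [hm]
  rw [← Real.exp_sum, ← Real.exp_sum, ← Real.exp_nat_mul, ← Real.exp_add, ← Real.exp_mul,
    ← Real.exp_mul, mul_assoc, mul_assoc, ← Real.exp_add, ← Real.exp_add]
  refine mul_le_mul_of_nonneg_left (Real.exp_le_exp.2 ?_) (by norm_num)
  rw [Finset.sum_range_succ]
  have h8 := mul_le_mul_of_nonneg_left (hml n) hs.le
  push_cast
  change m n * (1 - s) + (∑ i ∈ Finset.range n, (ψ i + e i) + 2 * (ψ n + e n)) * s ≤ _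
  change _ ≤ B + (∑ i ∈ Finset.range n, m i + m n)
  change s * ψ n ≤ s * m n at h8
  nlinarith

lemma lower_aux (ψ : ℕ → ℝ) (hψpos : ∀ n, 0 < ψ n) (hψmono : Monotone ψ)
    (s C : ℝ) (hs : 0 < s) (hs1 : s < 1) (hC : 0 < C)
    (H : ∀ n, 2 * (MM ψ n : ℝ) ^ (1 - s) *
      ((∏ i ∈ Finset.range n, Real.exp (ψ i + (Real.log 6 + Real.log ((i:ℝ)+1)))) *
        Real.exp (ψ n + (Real.log 6 + Real.log ((n:ℝ)+1))) ^ 2) ^ s ≤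
      C * ∏ i ∈ Finset.range (n+1), (MM ψ i : ℝ))
    (y y' : ℝ) (hy : y ∈ Set.Ico (0:ℝ) 1) (hy' : y' ∈ Set.Ico (0:ℝ) 1) (n : ℕ)
    (hlt : dig (MM ψ) y n < dig (MM ψ) y' n) (h : ∀ i < n, dig (MM ψ) y i = dig (MM ψ) y' i) :
    |y - y'| ≤ C * |modEngel (cc ψ y) - modEngel (cc ψ y')| ^ s := by
  obtain ⟨k, hk⟩ := Nat.exists_eq_add_of_lt hlt
  have hk : dig (MM ψ) y' n = dig (MM ψ) y n + (k + 1) := by omega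
  have hM2 := MM_two ψ hψpos
  have hc : ∀ i < n, cc ψ y i = cc ψ y' i := fun i hi => Finset.sum_congr rfl fun j hj => by
    rw [h j (by have := Finset.mem_range.1 hj; omega)]
  have hcn : cc ψ y' n = cc ψ y n + 2 * (k+1) := by
    rw [cc, cc, Finset.sum_range_succ, Finset.sum_range_succ,
      Finset.sum_congr rfl (fun j hj => by rw [← h j (Finset.mem_range.1 hj)]), hk]
    ring
  have hsep := modEngel_sep (cc ψ y) (cc ψ y') (cc_mono ψ hψpos y) (cc_zero ψ hψpos y)
    (cc_mono ψ hψpos y') (cc_zero ψ hψpos y') n (k+1) hc (by omega) hcn _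
    (cc_le ψ hψpos hψmono y hy) (cc_le ψ hψpos hψmono y' hy')
  have hd := dig_dist (MM ψ) hM2 y y' hy hy' n (k+1) h (by omega) hk
  have hlt' := dig_lt (MM ψ) hM2 y' hy' n
  have hQ : 0 < ∏ i ∈ Finset.range (n+1), (MM ψ i : ℝ) :=
    Finset.prod_pos fun i _ => by have := hM2 i; positivity
  refine holder_arith s C _ _ (MM ψ n) _ _ _ hs hs1 ?_ ?_ hQ ?_ (hsep.trans (le_abs_self _)) hd hC (H n)
  · simp
  · exact_mod_cast (by omega : k + 1 ≤ MM ψ n)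
  · positivity

lemma lower_bound (ψ : ℕ → ℝ) (hψpos : ∀ n, 0 < ψ n) (hψmono : Monotone ψ)
    (hψ : Tendsto (fun n : ℕ => ψ n / Real.log ((n : ℝ) + 1)) atTop atTop)
    (s z : ℝ) (hs : 0 < s) (hz : 0 ≤ z) (hsz : s * (1 + z) < 1)
    (hev : ∀ᶠ n in atTop, ψ n ≤ z * ∑ k ∈ Finset.range n, ψ k) :
    ENNReal.ofReal s ≤ dimH {x : ℝ | ∃ c : ℕ → ℕ, StrictMono c ∧ 2 ≤ c 0 ∧
        Tendsto (fun n : ℕ => Real.log ((c (n + 1) : ℝ) - (c n : ℝ)) / ψ (n + 1)) atTop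
          (nhds 1) ∧
        x = modEngel c} := by
  obtain ⟨C, hC, H⟩ := const_exists ψ hψpos hψ s z hs hz hsz hev
  have hs1 : s < 1 := by nlinarith
  have hM2 := MM_two ψ hψpos
  have key := dim_of_antiholder (fun y => modEngel (cc ψ y)) (Set.Ico 0 1) C s hC.le hs (by
    intro y hy y' hy'
    by_cases hne : y = y'
    · subst hne; simp; positivity
    have hex := dig_diff (MM ψ) hM2 y y' hy hy' hne
    classical
    have hn := Nat.find_spec hex
    have hmin : ∀ i < Nat.find hex, dig (MM ψ) y i = dig (MM ψ) y' i := fun i hi => by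
      simpa using Nat.find_min hex hi
    rcases lt_or_gt_of_ne hn with hlt | hlt
    · exact lower_aux ψ hψpos hψmono s C hs hs1 hC H y y' hy hy' _ hlt hmin
    · rw [abs_sub_comm y, abs_sub_comm (modEngel _)]
      exact lower_aux ψ hψpos hψmono s C hs hs1 hC H y' y hy' hy _ hlt (fun i hi => (hmin i hi).symm))
  rw [Real.dimH_of_nonempty_interior (by simp [interior_Ico])] at key
  simp only [Module.finrank_self, Nat.cast_one, mul_one] at key
  refine key.trans (dimH_mono ?_)
  rintro _ ⟨y, hy, rfl⟩
  exact ⟨cc ψ y, cc_mono ψ hψpos y, cc_zero ψ hψpos y, cc_lim ψ hψpos hψ y hy, rfl⟩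

end lower

section upper

def dd (c : ℕ → ℕ) : ℕ → ℕ
  | 0 => c 0
  | n+1 => c (n+1) - c n

lemma dd_congr (c c' : ℕ → ℕ) (hc : StrictMono c) (hc' : StrictMono c') (n : ℕ)
    (h : ∀ i < n, dd c i = dd c' i) : ∀ i < n, c i = c' i := by
  intro i
  induction i with
  | zero => intro hi; exact h 0 hi
  | succ i ih =>
    intro hi
    have h1 := h (i+1) hi
    have h2 := ih (by omega)
    have h3 := hc (Nat.lt_succ_self i)
    have h4 := hc' (Nat.lt_succ_self i)
    simp only [dd, Nat.succ_eq_add_one] at *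
    omega

lemma dd_pos (c : ℕ → ℕ) (hc : StrictMono c) (h0 : 2 ≤ c 0) (n : ℕ) : 0 < dd c n := by
  cases n with
  | zero => simp only [dd]; omega
  | succ n => simp only [dd]; have := hc (Nat.lt_succ_self n); simp only [Nat.succ_eq_add_one] at *; omega

def Good (ψ : ℕ → ℝ) (ε : ℝ) (K : ℕ) (c : ℕ → ℕ) : Prop :=
  StrictMono c ∧ 2 ≤ c 0 ∧ ∀ i, Real.exp ((1-ε) * ψ i - K) ≤ (c i : ℝ) - 1 ∧
    (dd c i : ℝ) ≤ Real.exp ((1+ε) * ψ i + K)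

lemma exists_good (ψ : ℕ → ℝ) (hψpos : ∀ n, 0 < ψ n) (ε : ℝ) (hε : 0 < ε) (c : ℕ → ℕ)
    (hc : StrictMono c) (h0 : 2 ≤ c 0)
    (h : Tendsto (fun n : ℕ => Real.log ((c (n + 1) : ℝ) - (c n : ℝ)) / ψ (n + 1)) atTop
          (nhds 1)) : ∃ K : ℕ, Good ψ ε K c := by
  obtain ⟨C, hC⟩ := exists_bound (fun i => max ((1-ε) * ψ i - Real.log ((c i : ℝ) - 1))
    (Real.log (dd c i) - (1+ε) * ψ i)) 0 (by
      obtain ⟨N, hN⟩ := eventually_atTop.1 ((Metric.tendsto_nhds.1 h) ε hε)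
      refine eventually_atTop.2 ⟨N+1, fun i hi => ?_⟩
      obtain ⟨j, rfl⟩ : ∃ j, i = j + 1 := ⟨i - 1, by omega⟩
      have h1 := hN j (by omega)
      rw [Real.dist_eq, abs_lt] at h1
      have hp := hψpos (j+1)
      have h2 : Real.log ((c (j + 1) : ℝ) - (c j : ℝ)) < (1 + ε) * ψ (j+1) := by
        rw [← div_lt_iff₀ hp]; linarith
      have h3 : (1 - ε) * ψ (j+1) < Real.log ((c (j + 1) : ℝ) - (c j : ℝ)) := by
        rw [← lt_div_iff₀ hp]; linarith
      have h4 : (c j : ℝ) + 1 ≤ c (j+1) := by exact_mod_cast hc (Nat.lt_succ_self j)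
      have h5 := cge c hc h0 j
      have h6 : Real.log ((c (j + 1) : ℝ) - (c j : ℝ)) ≤ Real.log ((c (j + 1) : ℝ) - 1) :=
        Real.log_le_log (by linarith) (by linarith)
      have h7 : (dd c (j+1) : ℝ) = (c (j + 1) : ℝ) - (c j : ℝ) := by
        simp only [dd]
        rw [Nat.cast_sub (hc (Nat.lt_succ_self j)).le]
      rw [h7]
      apply max_le <;> linarith)
  refine ⟨⌈C⌉₊, hc, h0, fun i => ?_⟩
  have h1 := (hC i).trans (Nat.le_ceil C)
  have h2 := (le_max_left _ _).trans h1
  have h3 := (le_max_right _ _).trans h1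
  have h4 := cge c hc h0 i
  have h5 : (0:ℝ) < dd c i := by exact_mod_cast dd_pos c hc h0 i
  constructor
  · rw [← Real.le_log_iff_exp_le (by linarith)]; linarith
  · rw [← Real.log_le_iff_le_exp h5]; linarith

lemma good_dist (ψ : ℕ → ℝ) (ε : ℝ) (K : ℕ) (c c' : ℕ → ℕ) (hc : Good ψ ε K c)
    (hc' : Good ψ ε K c') (n : ℕ) (h : ∀ i < n, dd c i = dd c' i) :
    |modEngel c - modEngel c'| ≤ Real.exp (-∑ i ∈ Finset.range (n+1), ((1-ε) * ψ i - K)) := by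
  have hcc := dd_congr c c' hc.1 hc'.1 n h
  have e : ∀ c, Good ψ ε K c → 1 / eP c (n+1) ≤
      Real.exp (-∑ i ∈ Finset.range (n+1), ((1-ε) * ψ i - K)) := by
    intro c hc
    rw [Real.exp_neg, Real.exp_sum, ← one_div]
    apply one_div_le_one_div_of_le (Finset.prod_pos fun i _ => Real.exp_pos _)
    exact Finset.prod_le_prod (fun i _ => (Real.exp_pos _).le) (fun i _ => (hc.2.2 i).1)
  have u1 := modEngel_upper c hc.1 hc.2.1 n
  have l1 := modEngel_lower c hc.1 hc.2.1 n
  have u2 := modEngel_upper c' hc'.1 hc'.2.1 n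
  have l2 := modEngel_lower c' hc'.1 hc'.2.1 n
  have t1 := eT_nonneg c hc.1 hc.2.1 n
  have t2 := eT_nonneg c' hc'.1 hc'.2.1 n
  rw [← eT_congr c c' n hcc] at u2 l2
  have := e c hc
  have := e c' hc'
  rw [abs_le]; constructor <;> linarith

lemma good_dim (ψ : ℕ → ℝ) (hψpos : ∀ n, 0 < ψ n)
    (hψ : Tendsto (fun n : ℕ => ψ n / Real.log ((n : ℝ) + 1)) atTop atTop)
    (t z ε : ℝ) (ht : 0 < t) (hε : 0 < ε) (hε' : 2 * ε < 1)
    (htz : 1 + 2 * ε ≤ t * (1 - 2 * ε) * (1 + z)) (K : ℕ)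
    (hfr : ∃ᶠ n in atTop, z * ∑ k ∈ Finset.range n, ψ k ≤ ψ n) :
    dimH {x : ℝ | ∃ c, Good ψ ε K c ∧ x = modEngel c} ≤ ENNReal.ofReal t := by
  have hS := sum_tendsto ψ hψpos hψ
  have ev1 := sum_small ψ hψpos hψ _ (const_littleO ψ hψ ((K:ℝ) + 1)) ε hε
  have ev2 := (tendsto_add_atTop_nat 1).eventually
    (sum_small ψ hψpos hψ _ (const_littleO ψ hψ (K:ℝ)) ε hε)
  obtain ⟨φ, hφ, hP⟩ := extraction_of_frequently_atTop (hfr.and_eventually (ev1.and ev2))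
  let D : ℕ → ℕ := fun i => ⌊Real.exp ((1+ε) * ψ i + K)⌋₊
  let R : ℕ → ℝ := fun n => Real.exp (-((1 - 2 * ε) * ∑ i ∈ Finset.range (n+1), ψ i))
  have hR : ∀ j, Real.exp (-∑ i ∈ Finset.range (φ j+1), ((1-ε) * ψ i - K)) ≤ R (φ j) := by
    intro j
    apply Real.exp_le_exp.2
    have := (hP j).2.2
    rw [Finset.sum_sub_distrib, ← Finset.mul_sum]
    linarith
  let T : ∀ j : ℕ, (∀ i : Fin (φ j), Fin (D i + 1)) → Set ℝ := fun j w =>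
    {x | ∃ c, Good ψ ε K c ∧ (∀ i : Fin (φ j), dd c i = w i) ∧ x = modEngel c}
  have hdiam : ∀ j w, Metric.ediam (T j w) ≤ ENNReal.ofReal (R (φ j)) := by
    intro j w
    apply Metric.ediam_le
    rintro _ ⟨c, hc, hcw, rfl⟩ _ ⟨c', hc', hcw', rfl⟩
    rw [edist_dist, Real.dist_eq]
    apply ENNReal.ofReal_le_ofReal
    refine (good_dist ψ ε K c c' hc hc' (φ j) fun i hi => ?_).trans (hR j)
    exact (hcw ⟨i, hi⟩).trans (hcw' ⟨i, hi⟩).symm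
  have hRlim : Tendsto (fun j => ENNReal.ofReal (R (φ j))) atTop (nhds 0) := by
    rw [← ENNReal.ofReal_zero]
    apply ENNReal.tendsto_ofReal
    have : Tendsto R atTop (nhds 0) := by
      apply Real.tendsto_exp_neg_atTop_nhds_zero.comp
      exact (hS.comp (tendsto_add_atTop_nat 1)).const_mul_atTop (by linarith)
    exact this.comp hφ.tendsto_atTop
  have hcov : ∀ j, {x : ℝ | ∃ c, Good ψ ε K c ∧ x = modEngel c} ⊆ ⋃ w, T j w := by
    rintro j _ ⟨c, hc, rfl⟩
    refine Set.mem_iUnion.2 ⟨fun i => ⟨dd c i, ?_⟩, c, hc, fun i => rfl, rfl⟩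
    exact Nat.lt_succ_of_le (Nat.le_floor (hc.2.2 i).2)
  have hsum : ∀ j, ∑ w, Metric.ediam (T j w) ^ t ≤ 1 := by
    intro j
    obtain ⟨p1, p2, p3⟩ := hP j
    have hRpos : 0 < R (φ j) := Real.exp_pos _
    calc ∑ w, Metric.ediam (T j w) ^ t
        ≤ ∑ w : (∀ i : Fin (φ j), Fin (D i + 1)), ENNReal.ofReal (R (φ j) ^ t) := by
          refine Finset.sum_le_sum fun w _ => ?_
          rw [← ENNReal.ofReal_rpow_of_nonneg hRpos.le ht.le]
          exact ENNReal.rpow_le_rpow (hdiam j w) ht.le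
      _ = ENNReal.ofReal ((∏ i ∈ Finset.range (φ j), ((D i : ℝ) + 1)) * R (φ j) ^ t) := by
          rw [Finset.sum_const, Finset.card_univ, Fintype.card_pi, nsmul_eq_mul,
            ENNReal.ofReal_mul (Finset.prod_nonneg fun i _ => by positivity)]
          congr 1
          simp only [Fintype.card_fin]
          rw [Fin.prod_univ_eq_prod_range (fun i => D i + 1) (φ j), ← ENNReal.ofReal_natCast]
          push_cast; rfl
      _ ≤ ENNReal.ofReal 1 := by
          apply ENNReal.ofReal_le_ofReal
          have b1 : ∏ i ∈ Finset.range (φ j), ((D i : ℝ) + 1) ≤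
              Real.exp ((1 + 2 * ε) * ∑ i ∈ Finset.range (φ j), ψ i) := by
            calc _ ≤ ∏ i ∈ Finset.range (φ j), Real.exp ((1+ε) * ψ i + (K + 1)) := by
                  refine Finset.prod_le_prod (fun i _ => by positivity) fun i _ => ?_
                  have h1 : (D i : ℝ) ≤ Real.exp ((1+ε) * ψ i + K) := Nat.floor_le (Real.exp_pos _).le
                  have h2 : 1 ≤ Real.exp ((1+ε) * ψ i + K) := Real.one_le_exp (by
                    have := hψpos i; positivity)
                  have h3 : 2 ≤ Real.exp 1 := by
                    have := Real.add_one_le_exp 1; linarith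
                  rw [← add_assoc, Real.exp_add _ 1]
                  nlinarith
              _ ≤ _ := by
                  rw [← Real.exp_sum, Real.exp_le_exp, Finset.sum_add_distrib, ← Finset.mul_sum]
                  linarith
          have b2 : R (φ j) ^ t ≤ Real.exp (-((1 + 2 * ε) * ∑ i ∈ Finset.range (φ j), ψ i)) := by
            simp only [R]
            rw [← Real.exp_mul, Real.exp_le_exp, Finset.sum_range_succ]
            have h0 : 0 ≤ ∑ i ∈ Finset.range (φ j), ψ i := Finset.sum_nonneg fun i _ => (hψpos i).le
            set S := ∑ i ∈ Finset.range (φ j), ψ i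
            have q1 := mul_le_mul_of_nonneg_right htz h0
            have q2 : 0 ≤ t * (1 - 2 * ε) := mul_nonneg ht.le (by linarith)
            have q3 := mul_le_mul_of_nonneg_left p1 q2
            nlinarith
          calc _ ≤ Real.exp ((1 + 2 * ε) * ∑ i ∈ Finset.range (φ j), ψ i) *
                Real.exp (-((1 + 2 * ε) * ∑ i ∈ Finset.range (φ j), ψ i)) := by
                  gcongr
            _ = 1 := by rw [← Real.exp_add]; simp
      _ = 1 := by simp
  have hmeas := MeasureTheory.Measure.hausdorffMeasure_le_liminf_sum t
    {x : ℝ | ∃ c, Good ψ ε K c ∧ x = modEngel c} (fun j => ENNReal.ofReal (R (φ j))) hRlim T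
    (Eventually.of_forall hdiam) (Eventually.of_forall hcov)
  have h1 : liminf (fun j => ∑ w, Metric.ediam (T j w) ^ t) atTop ≤ 1 := by
    calc _ ≤ liminf (fun _ : ℕ => (1:ℝ≥0∞)) atTop := liminf_le_liminf (Eventually.of_forall hsum)
      _ = 1 := liminf_const _
  have := dimH_le_of_hausdorffMeasure_ne_top (d := t.toNNReal)
    (s := {x : ℝ | ∃ c, Good ψ ε K c ∧ x = modEngel c}) (by
      rw [Real.coe_toNNReal t ht.le]
      exact ((hmeas.trans h1).trans_lt ENNReal.one_lt_top).ne)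
  exact this

lemma upper_bound (ψ : ℕ → ℝ) (hψpos : ∀ n, 0 < ψ n)
    (hψ : Tendsto (fun n : ℕ => ψ n / Real.log ((n : ℝ) + 1)) atTop atTop)
    (t z : ℝ) (ht : 0 < t) (hz : 0 ≤ z) (htz : 1 < t * (1 + z))
    (hfr : ∃ᶠ n in atTop, z * ∑ k ∈ Finset.range n, ψ k ≤ ψ n) :
    dimH {x : ℝ | ∃ c : ℕ → ℕ, StrictMono c ∧ 2 ≤ c 0 ∧
        Tendsto (fun n : ℕ => Real.log ((c (n + 1) : ℝ) - (c n : ℝ)) / ψ (n + 1)) atTop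
          (nhds 1) ∧
        x = modEngel c} ≤ ENNReal.ofReal t := by
  obtain ⟨ε, hε, hε', h⟩ : ∃ ε > 0, 2 * ε < 1 ∧ 1 + 2 * ε ≤ t * (1 - 2 * ε) * (1 + z) := by
    have hA : 0 < t * (1 + z) := by linarith
    set A := t * (1+z)
    refine ⟨(A - 1) / (2 * (A + 1)), by apply div_pos <;> linarith, ?_, ?_⟩
    · rw [← mul_div_assoc, div_lt_one (by linarith)]; linarith
    · rw [mul_right_comm]
      change _ ≤ A * _
      apply le_of_eq
      field_simp
      ring
  calc _ ≤ dimH (⋃ K : ℕ, {x : ℝ | ∃ c, Good ψ ε K c ∧ x = modEngel c}) := by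
        apply dimH_mono
        rintro _ ⟨c, hc, h0, hl, rfl⟩
        obtain ⟨K, hK⟩ := exists_good ψ hψpos ε hε c hc h0 hl
        exact Set.mem_iUnion.2 ⟨K, c, hK, rfl⟩
    _ ≤ _ := by
        rw [dimH_iUnion]
        exact iSup_le fun K => good_dim ψ hψpos hψ t z ε ht hε hε' h K hfr

end upper

/-- If `ψ` is nondecreasing with `ψ(n)/log n → ∞`, then the set of numbers
whose modified Engel digits satisfy `lim log(c_n − c_{n−1})/ψ(n) = 1` has Hausdorff dimension
`1/(1+ζ)`. -/
theorem dimH_modEngel_log_difference (ψ : ℕ → ℝ) (hψpos : ∀ n, 0 < ψ n)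
    (hψmono : Monotone ψ)
    (hψ : Tendsto (fun n : ℕ => ψ n / Real.log ((n : ℝ) + 1)) atTop atTop) :
    dimH {x : ℝ | ∃ c : ℕ → ℕ, StrictMono c ∧ 2 ≤ c 0 ∧
        Tendsto (fun n : ℕ => Real.log ((c (n + 1) : ℝ) - (c n : ℝ)) / ψ (n + 1)) atTop
          (nhds 1) ∧
        x = modEngel c} = 1 / (1 + zetaExp ψ) := by
  have hS : ∀ᶠ n in atTop, 0 < ∑ k ∈ Finset.range n, ψ k :=
    (sum_tendsto ψ hψpos hψ).eventually_gt_atTop 0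
  apply le_antisymm
  · refine le_of_forall_gt_imp_ge_of_dense fun T hT => ?_
    by_cases h1 : 1 ≤ T
    · refine le_trans ?_ h1
      refine (dimH_mono (Set.subset_univ _)).trans ?_
      simp [Real.dimH_univ]
    push Not at h1
    have hTtop : T ≠ ⊤ := h1.ne_top
    have hT0 : 0 < T := bot_le.trans_lt hT
    set t := T.toReal with htdef
    have ht0 : 0 < t := ENNReal.toReal_pos hT0.ne' hTtop
    have hTt : T = ENNReal.ofReal t := (ENNReal.ofReal_toReal hTtop).symm
    have ht1 : t < 1 := by
      rw [hTt, ← ENNReal.ofReal_one, ENNReal.ofReal_lt_ofReal_iff one_pos] at h1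
      exact h1
    have h2 : ENNReal.ofReal (1 / t - 1) < zetaExp ψ := by
      by_contra! hcon
      have : 1 + zetaExp ψ ≤ ENNReal.ofReal (1 / t) := by
        have ha : (1:ℝ) ≤ 1 / t := by rw [le_div_iff₀ ht0]; linarith
        calc 1 + zetaExp ψ ≤ ENNReal.ofReal 1 + ENNReal.ofReal (1 / t - 1) := by
              rw [ENNReal.ofReal_one]; gcongr
          _ = _ := by
              rw [← ENNReal.ofReal_add (by norm_num) (by linarith)]; congr 1; ring
      have h3 : T ≤ 1 / (1 + zetaExp ψ) := by
        rw [hTt, ENNReal.le_div_iff_mul_le (by simp) (by simp)]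
        calc ENNReal.ofReal t * (1 + zetaExp ψ) ≤ ENNReal.ofReal t * ENNReal.ofReal (1 / t) := by
              gcongr
          _ = 1 := by
              rw [← ENNReal.ofReal_mul ht0.le, mul_one_div_cancel ht0.ne', ENNReal.ofReal_one]
      exact absurd hT (not_lt.2 h3)
    obtain ⟨Z, hZ1, hZ2⟩ := ENNReal.lt_iff_exists_nnreal_btwn.1 h2
    have hz : 1 / t - 1 < Z := by
      rw [← ENNReal.ofReal_coe_nnreal] at hZ1
      exact lt_of_not_ge fun h => absurd (ENNReal.ofReal_le_ofReal h) (not_le.2 hZ1)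
    rw [hTt]
    refine upper_bound ψ hψpos hψ t Z ht0 Z.2 ?_ ?_
    · have : 1 / t < 1 + Z := by linarith
      rw [div_lt_iff₀ ht0] at this
      linarith
    · have h4 := frequently_lt_of_lt_limsup (by isBoundedDefault) hZ2
      refine (h4.and_eventually hS).mono fun n hn => ?_
      obtain ⟨h5, h6⟩ := hn
      rw [← ENNReal.ofReal_coe_nnreal] at h5
      have h7 := (ENNReal.ofReal_lt_ofReal_iff_of_nonneg Z.2).1 h5
      exact ((lt_div_iff₀ h6).1 h7).le
  · refine le_of_forall_lt_imp_le_of_dense fun T hT => ?_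
    by_cases h0 : T = 0
    · rw [h0]; exact zero_le
    have hTtop : T ≠ ⊤ := hT.ne_top
    set t := T.toReal with htdef
    have ht0 : 0 < t := ENNReal.toReal_pos h0 hTtop
    have hTt : T = ENNReal.ofReal t := (ENNReal.ofReal_toReal hTtop).symm
    have hlt : zetaExp ψ < ENNReal.ofReal (1 / t - 1) := by
      by_contra! hcon
      have : ENNReal.ofReal (1 / t) ≤ 1 + zetaExp ψ := by
        calc ENNReal.ofReal (1 / t) = ENNReal.ofReal (1 + (1 / t - 1)) := by congr 1; ring
          _ ≤ ENNReal.ofReal 1 + ENNReal.ofReal (1 / t - 1) := ENNReal.ofReal_add_le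
          _ ≤ _ := by rw [ENNReal.ofReal_one]; gcongr
      have h3 : 1 / (1 + zetaExp ψ) ≤ T := by
        apply ENNReal.div_le_of_le_mul
        calc 1 = ENNReal.ofReal t * ENNReal.ofReal (1 / t) := by
              rw [← ENNReal.ofReal_mul ht0.le, mul_one_div_cancel ht0.ne', ENNReal.ofReal_one]
          _ ≤ _ := by rw [hTt]; gcongr
      exact absurd hT (not_lt.2 h3)
    obtain ⟨Z, hZ1, hZ2⟩ := ENNReal.lt_iff_exists_nnreal_btwn.1 hlt
    have hz : (Z:ℝ) < 1 / t - 1 := by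
      rw [← ENNReal.ofReal_coe_nnreal] at hZ2
      exact (ENNReal.ofReal_lt_ofReal_iff_of_nonneg Z.2).1 hZ2
    rw [hTt]
    refine lower_bound ψ hψpos hψmono hψ t Z ht0 Z.2 ?_ ?_
    · have : 1 + Z < 1 / t := by linarith
      rw [lt_div_iff₀ ht0] at this
      linarith
    · have h4 := eventually_lt_of_limsup_lt hZ1
      filter_upwards [h4, hS] with n h5 h6
      rw [← ENNReal.ofReal_coe_nnreal] at h5
      have h7 := lt_of_not_ge fun h => absurd (ENNReal.ofReal_le_ofReal h) (not_le.2 h5)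
      exact ((div_lt_iff₀ h6).1 h7).le
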